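/- Consider the 1-dimensional MANET with disconnected boundary conditions, with n nodes uniformly distributed on [0,ℓ(n)] and radio range r(n) > 0, ℓ(n) > 0, and let ρ_n = r(n)/ℓ(n). Suppose there are ε > 0 and N such that n·r(n) ≤ (1−ε)·ℓ(n)·ln n for all n ≥ N. Then the probability of connectedness satisfies P_{CONN-DB}(n, ρ_n) → 0 as n → ∞. -/

import Mathlib

open MeasureTheory Filter

/-- The coordinates of `x` sorted in nondecreasing order. -/
noncomputable def sortedCoords {n : ℕ} (x : Fin n → ℝ) : Fin n → ℝ :=
  fun i => x (Tuple.sort x i)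

/-- The circular gaps of `x`: for `i+1 < n` the gap `x'_{i+1} - x'_i` between consecutive
sorted coordinates, and for the last index the boundary gap `x'_1 + 1 - x'_n`. -/
noncomputable def circGap {n : ℕ} (x : Fin n → ℝ) (i : Fin n) : ℝ :=
  if h : (i : ℕ) + 1 < n then sortedCoords x ⟨(i : ℕ) + 1, h⟩ - sortedCoords x i
  else sortedCoords x ⟨0, i.pos⟩ + 1 - sortedCoords x i

/-- The unit cube `[0,1]^n`, the sample space of the normalized model. -/
def unitBox (n : ℕ) : Set (Fin n → ℝ) := Set.univ.pi fun _ => Set.Icc (0 : ℝ) 1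

/-- The event DISC-PB(k): exactly `k` circular gaps are `≥ ρ`. -/
def discPB (n : ℕ) (ρ : ℝ) (k : ℕ) : Set (Fin n → ℝ) :=
  {x ∈ unitBox n | Nat.card {i : Fin n // ρ ≤ circGap x i} = k}

/-- The probability of DISC-PB(k). -/
noncomputable def P_discPB (n : ℕ) (ρ : ℝ) (k : ℕ) : ℝ :=
  (volume (discPB n ρ k)).toReal

/-- The event CONN-PB: all circular gaps are `< ρ`. -/
def connPB (n : ℕ) (ρ : ℝ) : Set (Fin n → ℝ) :=
  {x ∈ unitBox n | ∀ i, circGap x i < ρ}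

/-- The probability of CONN-PB. -/
noncomputable def P_connPB (n : ℕ) (ρ : ℝ) : ℝ :=
  (volume (connPB n ρ)).toReal

/-- The event DISC-DB(k): exactly `k` of the non-circular gaps
`x'_{i+1} - x'_i`, `i = 1, …, n-1`, are `≥ ρ`. -/
def discDB (n : ℕ) (ρ : ℝ) (k : ℕ) : Set (Fin n → ℝ) :=
  {x ∈ unitBox n | Nat.card {i : Fin n // (i : ℕ) + 1 < n ∧ ρ ≤ circGap x i} = k}

/-- The probability of DISC-DB(k). -/
noncomputable def P_discDB (n : ℕ) (ρ : ℝ) (k : ℕ) : ℝ :=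
  (volume (discDB n ρ k)).toReal

/-- The event CONN-DB: all gaps between consecutive sorted coordinates are `< ρ`. -/
def connDB (n : ℕ) (ρ : ℝ) : Set (Fin n → ℝ) :=
  {x ∈ unitBox n | ∀ i : Fin n, ∀ h : (i : ℕ) + 1 < n,
    sortedCoords x ⟨(i : ℕ) + 1, h⟩ - sortedCoords x i < ρ}

/-- The probability of CONN-DB. -/
noncomputable def P_connDB (n : ℕ) (ρ : ℝ) : ℝ :=
  (volume (connDB n ρ)).toReal

/-- The event S: the network is disconnected at the boundary,
`min_i x_i + 1 - max_i x_i ≥ ρ`. -/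
def boundaryDisc (n : ℕ) (ρ : ℝ) : Set (Fin n → ℝ) :=
  {x ∈ unitBox n | ρ ≤ (⨅ i, x i) + 1 - (⨆ i, x i)}

/-- Second moment bound: if the events `E k` have common probability `p` and are pairwise
non-positively correlated, then it is unlikely that none of them occurs. -/
lemma measureReal_compl_iUnion_mul_le {Ω ι : Type*} [MeasurableSpace Ω] [Fintype ι]
    (P : Measure Ω) [IsProbabilityMeasure P] (E : ι → Set Ω) (hE : ∀ k, MeasurableSet (E k))
    (p : ℝ) (hp : ∀ k, P.real (E k) = p)
    (hpair : ∀ k l, k ≠ l → P.real (E k ∩ E l) ≤ p ^ 2) :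
    (Fintype.card ι * p) ^ 2 * P.real (⋃ k, E k)ᶜ ≤ Fintype.card ι * p := by
  classical
  set f : Ω → ℝ := fun x => ∑ k, ((E k).indicator 1 x - p) with hf
  have hsq : ∀ x, f x ^ 2 = ∑ k, ∑ l, ((E k ∩ E l).indicator (1 : Ω → ℝ) x
      - p * (E k).indicator 1 x - p * (E l).indicator 1 x + p ^ 2) := by
    intro x
    simp only [hf, sq, Finset.sum_mul_sum]
    refine Finset.sum_congr rfl fun k _ => Finset.sum_congr rfl fun l _ => ?_
    rw [Set.inter_indicator_one]
    simp only [Pi.mul_apply]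
    ring
  have hint : ∀ S : Set Ω, MeasurableSet S → Integrable (S.indicator (1 : Ω → ℝ)) P :=
    fun S hS => (integrable_const (1 : ℝ)).indicator hS
  have hterm : ∀ k l, Integrable (fun x => (E k ∩ E l).indicator (1 : Ω → ℝ) x
      - p * (E k).indicator 1 x - p * (E l).indicator 1 x + p ^ 2) P := fun k l =>
    (((hint _ ((hE k).inter (hE l))).sub ((hint _ (hE k)).const_mul p)).sub
      ((hint _ (hE l)).const_mul p)).add (integrable_const _)
  have hval : ∀ k l, ∫ x, ((E k ∩ E l).indicator (1 : Ω → ℝ) x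
      - p * (E k).indicator 1 x - p * (E l).indicator 1 x + p ^ 2) ∂P
      = P.real (E k ∩ E l) - p ^ 2 := by
    intro k l
    have h1 := hint _ ((hE k).inter (hE l))
    have h2 := (hint _ (hE k)).const_mul p
    have h3 := (hint _ (hE l)).const_mul p
    have h12 : Integrable (fun x => (E k ∩ E l).indicator (1 : Ω → ℝ) x
        - p * (E k).indicator 1 x) P := h1.sub h2
    have h123 : Integrable (fun x => (E k ∩ E l).indicator (1 : Ω → ℝ) x
        - p * (E k).indicator 1 x - p * (E l).indicator 1 x) P := h12.sub h3
    rw [integral_add h123 (integrable_const _), integral_sub h12 h3,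
      integral_sub h1 h2, integral_const_mul, integral_const_mul,
      integral_indicator_one ((hE k).inter (hE l)), integral_indicator_one (hE k),
      integral_indicator_one (hE l), hp, hp]
    simp
    ring
  have hfint : Integrable (fun x => f x ^ 2) P := by
    simp only [hsq]
    exact integrable_finsetSum _ fun k _ => integrable_finsetSum _ fun l _ => hterm k l
  have hupper : ∫ x, f x ^ 2 ∂P ≤ Fintype.card ι * p := by
    simp only [hsq]
    rw [integral_finsetSum _ fun k _ => integrable_finsetSum _ fun l _ => hterm k l]
    have hrow : ∀ k, ∫ x, ∑ l, ((E k ∩ E l).indicator (1 : Ω → ℝ) x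
        - p * (E k).indicator 1 x - p * (E l).indicator 1 x + p ^ 2) ∂P ≤ p := by
      intro k
      rw [integral_finsetSum _ fun l _ => hterm k l]
      simp only [hval]
      calc ∑ l, (P.real (E k ∩ E l) - p ^ 2) ≤ ∑ l, if k = l then p else 0 := by
            refine Finset.sum_le_sum fun l _ => ?_
            split_ifs with hkl
            · subst hkl
              rw [Set.inter_self, hp]
              nlinarith [sq_nonneg p]
            · linarith [hpair k l hkl]
        _ = p := by simp
    calc _ ≤ ∑ _k : ι, p := Finset.sum_le_sum fun k _ => hrow k
      _ = _ := by simp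
  have hmeas : MeasurableSet (⋃ k, E k)ᶜ := (MeasurableSet.iUnion hE).compl
  calc (Fintype.card ι * p) ^ 2 * P.real (⋃ k, E k)ᶜ
      = ∫ x, (Fintype.card ι * p) ^ 2 * (⋃ k, E k)ᶜ.indicator (1 : Ω → ℝ) x ∂P := by
        rw [integral_const_mul, integral_indicator_one hmeas]
    _ ≤ ∫ x, f x ^ 2 ∂P := by
        refine integral_mono ((hint _ hmeas).const_mul _) hfint fun x => ?_
        by_cases hx : x ∈ (⋃ k, E k)ᶜ
        · have h0 : ∀ k, x ∉ E k := by simpa using hx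
          simp [hf, h0]
        · simp only [Set.indicator_of_notMem hx, mul_zero]
          positivity
    _ ≤ _ := hupper

/-- A connected configuration with points on both sides of an interval of length at least `ρ`
has a point in that interval. -/
lemma exists_mem_Ico_of_mem_connDB {n : ℕ} {ρ a b : ℝ} {x : Fin n → ℝ} (hx : x ∈ connDB n ρ)
    (hab : a + ρ ≤ b) (hlt : ∃ i, x i < a) (hge : ∃ i, b ≤ x i) (h0 : 0 ≤ ρ) :
    ∃ i, x i ∈ Set.Ico a b := by
  by_contra! hempty
  obtain ⟨i, hi⟩ := hlt
  obtain ⟨j, hj⟩ := hge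
  have hmono : Monotone (sortedCoords x) := Tuple.monotone_sort x
  have hsorted : ∀ i, sortedCoords x ((Tuple.sort x).symm i) = x i := fun i => by
    simp [sortedCoords]
  have hall : ∀ k : ℕ, ∀ hk : k < n, sortedCoords x ⟨k, hk⟩ < a := by
    intro k
    induction k with
    | zero =>
      intro hk
      refine lt_of_le_of_lt (hmono (Fin.mk_le_of_le_val (Nat.zero_le _))) ((hsorted i).trans_lt hi)
    | succ k ih =>
      intro hk
      have h1 := ih (by omega)
      have h2 := hx.2 ⟨k, by omega⟩ hk
      by_contra! h3
      exact hempty _ ⟨h3, by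
        change sortedCoords x ⟨k + 1, hk⟩ < b
        linarith⟩
  have := hall _ ((Tuple.sort x).symm j).2
  rw [Fin.eta, hsorted] at this
  linarith

/-- The uniform distribution on `[0,1]`. -/
noncomputable def unitUniform : Measure ℝ := volume.restrict (Set.Icc 0 1)

instance : IsProbabilityMeasure unitUniform := ⟨by simp [unitUniform]⟩

lemma unitUniform_real_Ico {a b : ℝ} (ha : 0 ≤ a) (hb : b ≤ 1) (hab : a ≤ b) :
    unitUniform.real (Set.Ico a b) = b - a := by
  have hsub : Set.Ico a b ⊆ Set.Icc 0 1 := fun y hy => ⟨ha.trans hy.1, hy.2.le.trans hb⟩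
  rw [measureReal_def, unitUniform, Measure.restrict_eq_self _ hsub, Real.volume_Ico,
    ENNReal.toReal_ofReal (by linarith)]

lemma pi_unitUniform_real_forall (n : ℕ) (S : Set ℝ) :
    (Measure.pi fun _ : Fin n => unitUniform).real {x | ∀ i, x i ∈ S}
      = unitUniform.real S ^ n := by
  have : {x : Fin n → ℝ | ∀ i, x i ∈ S} = Set.univ.pi fun _ => S := by ext; simp
  rw [this, measureReal_def, Measure.pi_pi]
  simp [measureReal_def]

lemma P_connDB_eq_pi (n : ℕ) (ρ : ℝ) :
    P_connDB n ρ = (Measure.pi fun _ : Fin n => unitUniform).real (connDB n ρ) := by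
  have hsub : connDB n ρ ⊆ Set.univ.pi fun _ => Set.Icc (0 : ℝ) 1 := fun x hx => hx.1
  rw [P_connDB, measureReal_def]
  simp only [unitUniform]
  rw [← Measure.restrict_pi_pi, Measure.restrict_eq_self _ hsub, volume_pi]

lemma P_connDB_mono (n : ℕ) : Monotone (P_connDB n) := by
  intro ρ ρ' hρ
  rw [P_connDB_eq_pi, P_connDB_eq_pi]
  exact measureReal_mono fun x hx => ⟨hx.1, fun i hi => (hx.2 i hi).trans_le hρ⟩

/-- Bound obtained from `m` disjoint intervals of length `ρ` in the middle third of `[0,1]`. -/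
lemma P_connDB_le (n m : ℕ) {ρ : ℝ} (h0 : 0 < ρ) (h1 : ρ < 1) (hm : 0 < m)
    (hmρ : m * ρ ≤ 1 / 3) :
    P_connDB n ρ ≤ 2 * (2 / 3) ^ n + (m * (1 - ρ) ^ n)⁻¹ := by
  set P := Measure.pi fun _ : Fin n => unitUniform with hP
  let I : Fin m → Set ℝ := fun k => Set.Ico (1 / 3 + k * ρ) (1 / 3 + k * ρ + ρ)
  let E : Fin m → Set (Fin n → ℝ) := fun k => {x | ∀ i, x i ∈ (I k)ᶜ}
  have hend : ∀ k : Fin m, 1 / 3 + k * ρ + ρ ≤ 2 / 3 := by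
    intro k
    have : ((k : ℕ) : ℝ) + 1 ≤ m := by exact_mod_cast k.2
    nlinarith
  have hstart : ∀ k : Fin m, 1 / 3 ≤ 1 / 3 + k * ρ := fun k => by
    have : 0 ≤ (k : ℝ) * ρ := by positivity
    linarith
  have hI : ∀ k, unitUniform.real (I k) = ρ := fun k => by
    rw [unitUniform_real_Ico (by linarith [hstart k]) (by linarith [hend k]) (by linarith)]
    ring
  have hdisj : ∀ k l, k ≠ l → Disjoint (I k) (I l) := by
    have key : ∀ k l : Fin m, k < l → Disjoint (I k) (I l) := by
      intro k l hkl
      rw [Set.disjoint_left]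
      intro y hy hy'
      have : ((k : ℕ) : ℝ) + 1 ≤ l := by exact_mod_cast hkl
      have h2 := hy.2
      have h3 := hy'.1
      nlinarith
    intro k l hkl
    rcases lt_or_gt_of_ne hkl with h | h
    · exact key k l h
    · exact (key l k h).symm
  have hmE : ∀ k, MeasurableSet (E k) := fun k => by
    have : E k = Set.univ.pi fun _ => (I k)ᶜ := by ext; simp [E]
    rw [this]
    exact MeasurableSet.univ_pi fun _ => measurableSet_Ico.compl
  have hpE : ∀ k, P.real (E k) = (1 - ρ) ^ n := fun k => by
    rw [hP, pi_unitUniform_real_forall, probReal_compl_eq_one_sub measurableSet_Ico, hI]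
  have hpair : ∀ k l, k ≠ l → P.real (E k ∩ E l) ≤ ((1 - ρ) ^ n) ^ 2 := by
    intro k l hkl
    have hEE : E k ∩ E l = {x | ∀ i, x i ∈ (I k ∪ I l)ᶜ} := by
      ext x
      simp [E, forall_and]
    have hU : unitUniform.real (I k ∪ I l)ᶜ = 1 - 2 * ρ := by
      rw [probReal_compl_eq_one_sub (measurableSet_Ico.union measurableSet_Ico),
        measureReal_union (hdisj k l hkl) measurableSet_Ico, hI, hI]
      ring
    rw [hEE, hP, pi_unitUniform_real_forall, ← pow_mul, mul_comm n 2, pow_mul]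
    refine pow_le_pow_left₀ measureReal_nonneg ?_ n
    rw [hU]
    nlinarith [sq_nonneg ρ]
  have hmain := measureReal_compl_iUnion_mul_le P E hmE _ hpE hpair
  rw [Fintype.card_fin] at hmain
  have hQ : 0 < m * (1 - ρ) ^ n := mul_pos (by exact_mod_cast hm) (pow_pos (by linarith) n)
  have hB : P.real (⋃ k, E k)ᶜ ≤ (m * (1 - ρ) ^ n)⁻¹ := by
    rw [← one_div, le_div_iff₀ hQ]
    nlinarith
  have hL : P.real {x | ∀ i, x i ∈ (Set.Ico (0 : ℝ) (1 / 3))ᶜ} = (2 / 3) ^ n := by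
    rw [hP, pi_unitUniform_real_forall, probReal_compl_eq_one_sub measurableSet_Ico,
      unitUniform_real_Ico le_rfl (by norm_num) (by norm_num)]
    norm_num
  have hR : P.real {x | ∀ i, x i ∈ (Set.Ico (2 / 3 : ℝ) 1)ᶜ} = (2 / 3) ^ n := by
    rw [hP, pi_unitUniform_real_forall, probReal_compl_eq_one_sub measurableSet_Ico,
      unitUniform_real_Ico (by norm_num) le_rfl (by norm_num)]
    norm_num
  have hsub : connDB n ρ ⊆ ({x | ∀ i, x i ∈ (Set.Ico (0 : ℝ) (1 / 3))ᶜ} ∪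
      {x | ∀ i, x i ∈ (Set.Ico (2 / 3 : ℝ) 1)ᶜ}) ∪ (⋃ k, E k)ᶜ := by
    intro x hx
    by_contra hcon
    simp only [Set.mem_union, not_or, Set.mem_ofPred_eq, not_forall, Set.mem_compl_iff,
      not_not] at hcon
    obtain ⟨⟨⟨i, hi⟩, ⟨j, hj⟩⟩, hu⟩ := hcon
    obtain ⟨k, hk⟩ := Set.mem_iUnion.1 hu
    obtain ⟨t, ht⟩ := exists_mem_Ico_of_mem_connDB hx le_rfl
      ⟨i, hi.2.trans_le (hstart k)⟩ ⟨j, (hend k).trans hj.1⟩ h0.le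
    exact hk t ht
  rw [P_connDB_eq_pi]
  calc P.real (connDB n ρ) ≤ _ := measureReal_mono hsub
    _ ≤ _ := measureReal_union_le _ _
    _ ≤ ((2 / 3) ^ n + (2 / 3) ^ n) + (m * (1 - ρ) ^ n)⁻¹ := by
        refine add_le_add ((measureReal_union_le _ _).trans ?_) hB
        rw [hL, hR]
    _ = _ := by ring

lemma exp_le_one_sub_pow {n : ℕ} {c c' ρ : ℝ} (hc : 0 < c) (hn : 0 < n) (hρ : 0 ≤ ρ)
    (hcc' : c / c' ≤ 1 - ρ) (hc' : 0 < c') :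
    Real.exp (-(c' / c * (n * ρ))) ≤ (1 - ρ) ^ n := by
  have hpos : 0 < 1 - ρ := lt_of_lt_of_le (by positivity) hcc'
  have h1 := Real.one_sub_inv_le_log_of_pos hpos
  have h2 : (1 - ρ)⁻¹ ≤ c' / c := by
    rw [← inv_div]
    exact inv_anti₀ (by positivity) hcc'
  have h3 : 1 - (1 - ρ)⁻¹ = -(ρ * (1 - ρ)⁻¹) := by field_simp; ring
  have h4 : -(c' / c * ρ) ≤ Real.log (1 - ρ) := by nlinarith
  rw [← Real.exp_log (pow_pos hpos n), Real.log_pow]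
  refine Real.exp_le_exp.2 ?_
  have : (0 : ℝ) < n := by exact_mod_cast hn
  nlinarith

lemma tendsto_P_connDB_mul_log_div {c : ℝ} (hc0 : 0 < c) (hc1 : c < 1) :
    Tendsto (fun n : ℕ => P_connDB n (c * (Real.log n / n))) atTop (nhds 0) := by
  set c' := (1 + c) / 2 with hc'
  have hlog : Tendsto (fun n : ℕ => Real.log n) atTop atTop :=
    Real.tendsto_log_atTop.comp tendsto_natCast_atTop_atTop
  have hρ : Tendsto (fun n : ℕ => c * (Real.log n / n)) atTop (nhds 0) := by
    have := (Real.isLittleO_log_id_atTop.tendsto_div_nhds_zero.comp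
      tendsto_natCast_atTop_atTop).const_mul c
    simpa using this
  have hgrow : Tendsto (fun n : ℕ => (6 * c)⁻¹ *
      (Real.exp ((1 - c') * Real.log n) / Real.log n)) atTop atTop := by
    refine Tendsto.const_mul_atTop (by positivity) ?_
    have := (tendsto_exp_mul_div_rpow_atTop 1 (1 - c') (by rw [hc']; linarith)).comp hlog
    simpa [Function.comp_def] using this
  have hbound : Tendsto (fun n : ℕ => 2 * (2 / 3 : ℝ) ^ n + ((6 * c)⁻¹ *
      (Real.exp ((1 - c') * Real.log n) / Real.log n))⁻¹) atTop (nhds 0) := by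
    have h1 := (tendsto_pow_atTop_nhds_zero_of_lt_one (r := (2 / 3 : ℝ)) (by norm_num)
      (by norm_num)).const_mul 2
    simpa using h1.add (tendsto_inv_atTop_zero.comp hgrow)
  refine tendsto_of_tendsto_of_tendsto_of_le_of_le' tendsto_const_nhds hbound
    (Eventually.of_forall fun n => ENNReal.toReal_nonneg) ?_
  have hcc' : c / c' < 1 := by
    rw [div_lt_one (by positivity), hc']
    linarith
  filter_upwards [hρ.eventually_le_const (show (0 : ℝ) < 1 / 6 by norm_num),
    hρ.eventually_le_const (show 0 < 1 - c / c' by linarith), hlog.eventually_gt_atTop 0,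
    eventually_gt_atTop 0] with n h6 hcn hL hn
  have hnR : (0 : ℝ) < n := by exact_mod_cast hn
  have hmul : n * (c * (Real.log n / n)) = c * Real.log n := by field_simp
  have hpos : 0 < c * (Real.log n / n) := by positivity
  have hinv : 1 / (6 * (c * (Real.log n / n))) = n * (6 * c)⁻¹ / Real.log n := by field_simp
  have hpow := exp_le_one_sub_pow (c' := c') hc0 hn hpos.le (by linarith) (by positivity)
  rw [hmul, show c' / c * (c * Real.log n) = c' * Real.log n by field_simp] at hpow
  set ρ := c * (Real.log n / n) with hρdef
  set m := ⌊1 / (3 * ρ)⌋₊ with hm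
  have hm1 : (m : ℝ) * ρ ≤ 1 / 3 := by
    have : (m : ℝ) ≤ 1 / (3 * ρ) := Nat.floor_le (by positivity)
    calc (m : ℝ) * ρ ≤ 1 / (3 * ρ) * ρ := by gcongr
      _ = 1 / 3 := by field_simp
  have hm2 : 1 / (6 * ρ) ≤ m := by
    have h1 : 1 / (3 * ρ) < m + 1 := Nat.lt_floor_add_one _
    have h2 : 1 ≤ 1 / (6 * ρ) := by rw [le_div_iff₀ (by positivity)]; linarith
    have h3 : 1 / (3 * ρ) = 1 / (6 * ρ) + 1 / (6 * ρ) := by field_simp; norm_num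
    linarith
  have hm0 : 0 < m := by
    have : (0 : ℝ) < m := lt_of_lt_of_le (by positivity) hm2
    exact_mod_cast this
  refine (P_connDB_le n m hpos (by linarith) hm0 hm1).trans ?_
  refine add_le_add le_rfl (inv_anti₀ (by positivity) ?_)
  calc (6 * c)⁻¹ * (Real.exp ((1 - c') * Real.log n) / Real.log n)
      = 1 / (6 * ρ) * Real.exp (-(c' * Real.log n)) := by
        rw [hinv, show (1 - c') * Real.log n = Real.log n + -(c' * Real.log n) by ring,
          Real.exp_add, Real.exp_log hnR]
        ring
    _ ≤ m * (1 - ρ) ^ n := by gcongr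

/-- if eventually `n·r(n) ≤ (1−ε)·ℓ(n)·ln n`, then the probability of
connectedness (disconnected boundary conditions, normalized range `ρ_n = r(n)/ℓ(n)`)
tends to `0`. -/
theorem P_connDB_subcritical (r ℓ : ℕ → ℝ) (hr : ∀ n, 0 < r n) (hℓ : ∀ n, 0 < ℓ n)
    (h : ∃ ε > (0 : ℝ), ∃ N : ℕ, ∀ n ≥ N, (n : ℝ) * r n ≤ (1 - ε) * (ℓ n * Real.log n)) :
    Tendsto (fun n : ℕ => P_connDB n (r n / ℓ n)) atTop (nhds 0) := by
  obtain ⟨ε, hε, N, hN⟩ := h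
  have hε1 : ε < 1 := by
    by_contra! hge
    have h1 := hN (max N 2) (le_max_left _ _)
    have h2 : (2 : ℝ) ≤ (max N 2 : ℕ) := by exact_mod_cast le_max_right N 2
    have h3 : 0 < Real.log (max N 2 : ℕ) := Real.log_pos (by linarith)
    have h4 := mul_pos (hℓ (max N 2)) h3
    have h5 := mul_pos (show (0 : ℝ) < (max N 2 : ℕ) by linarith) (hr (max N 2))
    nlinarith
  refine tendsto_of_tendsto_of_tendsto_of_le_of_le' tendsto_const_nhds
    (tendsto_P_connDB_mul_log_div (c := 1 - ε) (by linarith) (by linarith))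
    (Eventually.of_forall fun n => ENNReal.toReal_nonneg) ?_
  filter_upwards [eventually_ge_atTop N, eventually_gt_atTop 0] with n hn hn0
  have hnR : (0 : ℝ) < n := by exact_mod_cast hn0
  refine P_connDB_mono n ?_
  rw [div_le_iff₀ (hℓ n), ← mul_le_mul_iff_right₀ hnR]
  calc (n : ℝ) * r n ≤ (1 - ε) * (ℓ n * Real.log n) := hN n hn
    _ = n * ((1 - ε) * (Real.log n / n) * ℓ n) := by field_simp
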